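/- Let (Ω, 𝓕, (𝓕_t)_{t≥0}, ℙ) be a filtered probability space, H a separable real Hilbert space, T > 0, and let M = (M_t)_{t∈[0,T]} and N = (N_t)_{t∈[0,T]} be real-valued martingales with 𝔼[M_t²] < ∞ and 𝔼[N_t²] < ∞ for all t, whose product (M_t N_t)_{t∈[0,T]} is again a martingale. Let 0 = t_1 < t_2 < … < t_{n+1} = T and for each i = 1, …, n let X_i, Y_i : Ω → H be bounded 𝓕_{t_i}-measurable random variables. Then the stochastic integrals of the corresponding simple processes are orthogonal in L²(Ω; H): 𝔼[⟨Σ_{i=1}^n X_i (M_{t_{i+1}} − M_{t_i}), Σ_{i=1}^n Y_i (N_{t_{i+1}} − N_{t_i})⟩_H] = 0. -/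

import Mathlib

open MeasureTheory Filter Set
open scoped RealInnerProductSpace

/-- A random variable with vanishing conditional expectation given `𝒢` is orthogonal to every
`𝒢`-measurable random variable whose product with it is integrable. -/
theorem integral_mul_eq_zero_of_condExp_eq_zero {Ω : Type*} {𝒢 m : MeasurableSpace Ω}
    {μ : Measure Ω} [IsFiniteMeasure μ] (h𝒢 : 𝒢 ≤ m) {f g : Ω → ℝ}
    (hf : StronglyMeasurable[𝒢] f) (hg : Integrable g μ)
    (hfg : Integrable (fun ω => f ω * g ω) μ) (h : μ[g | 𝒢] =ᵐ[μ] 0) :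
    ∫ ω, f ω * g ω ∂μ = 0 := by
  rw [← integral_condExp h𝒢]
  refine integral_eq_zero_of_ae ?_
  filter_upwards [condExp_mul_of_stronglyMeasurable_left hf hfg hg, h] with ω h₁ h₂
  exact h₁.trans (by simp [h₂])

/-- A random variable minus its conditional expectation has vanishing conditional expectation. -/
theorem condExp_sub_eq_zero {Ω : Type*} {𝒢 m : MeasurableSpace Ω}
    {μ : Measure Ω} [IsFiniteMeasure μ] (h𝒢 : 𝒢 ≤ m) {f f₀ : Ω → ℝ}
    (hf₀ : StronglyMeasurable[𝒢] f₀) (hi : Integrable f μ) (hi₀ : Integrable f₀ μ)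
    (h : μ[f | 𝒢] =ᵐ[μ] f₀) :
    μ[fun ω => f ω - f₀ ω | 𝒢] =ᵐ[μ] 0 := by
  filter_upwards [condExp_sub hi hi₀ 𝒢, h] with ω h₁ h₂
  refine h₁.trans ?_
  simp [h₂, condExp_of_stronglyMeasurable h𝒢 hf₀ hi₀]

/-- If the conditional expectation given `𝒢` is multiplicative on the pair `f, g`, then the
conditional covariance of `f` and `g` vanishes. -/
theorem condExp_sub_mul_sub_eq_zero {Ω : Type*} {𝒢 m : MeasurableSpace Ω}
    {μ : Measure Ω} [IsFiniteMeasure μ] (h𝒢 : 𝒢 ≤ m) {f g f₀ g₀ : Ω → ℝ}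
    (hf₀ : StronglyMeasurable[𝒢] f₀) (hg₀ : StronglyMeasurable[𝒢] g₀)
    (hf : MemLp f 2 μ) (hg : MemLp g 2 μ) (hf₀' : MemLp f₀ 2 μ) (hg₀' : MemLp g₀ 2 μ)
    (h₁ : μ[f | 𝒢] =ᵐ[μ] f₀) (h₂ : μ[g | 𝒢] =ᵐ[μ] g₀)
    (h₃ : μ[fun ω => f ω * g ω | 𝒢] =ᵐ[μ] fun ω => f₀ ω * g₀ ω) :
    μ[fun ω => (f ω - f₀ ω) * (g ω - g₀ ω) | 𝒢] =ᵐ[μ] 0 := by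
  have hfg : Integrable (f * g) μ := hf.integrable_mul hg
  have hfg₀ : Integrable (f * g₀) μ := hf.integrable_mul hg₀'
  have hf₀g : Integrable (f₀ * g) μ := hf₀'.integrable_mul hg
  have hf₀g₀ : Integrable (f₀ * g₀) μ := hf₀'.integrable_mul hg₀'
  have hexp : (fun ω => (f ω - f₀ ω) * (g ω - g₀ ω)) = f * g - f * g₀ - (f₀ * g - f₀ * g₀) := by
    ext ω
    simp only [Pi.sub_apply, Pi.mul_apply]
    ring
  rw [hexp]
  filter_upwards [condExp_sub (hfg.sub hfg₀) (hf₀g.sub hf₀g₀) 𝒢, condExp_sub hfg hfg₀ 𝒢,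
    condExp_sub hf₀g hf₀g₀ 𝒢,
    condExp_mul_of_stronglyMeasurable_right hg₀ hfg₀ (hf.integrable one_le_two),
    condExp_mul_of_stronglyMeasurable_left hf₀ hf₀g (hg.integrable one_le_two),
    h₁, h₂, h₃] with ω e₁ e₂ e₃ e₄ e₅ e₆ e₇ e₈
  have e₉ : μ[f * g | 𝒢] ω = f₀ ω * g₀ ω := e₈
  have e₁₀ : μ[f₀ * g₀ | 𝒢] = f₀ * g₀ :=
    condExp_of_stronglyMeasurable h𝒢 (hf₀.mul hg₀) hf₀g₀
  simp only [Pi.sub_apply, Pi.mul_apply] at e₁ e₂ e₃ e₄ e₅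
  simp only [e₁, e₂, e₃, e₄, e₅, e₆, e₇, e₉, e₁₀, Pi.mul_apply, Pi.zero_apply]
  ring

/-- The product of two square-integrable functions with the inner product of two bounded functions
is integrable. -/
theorem MeasureTheory.MemLp.integrable_mul_mul_inner {Ω H : Type*} {m : MeasurableSpace Ω}
    {μ : Measure Ω} [NormedAddCommGroup H] [InnerProductSpace ℝ H] {f g : Ω → ℝ} {x y : Ω → H}
    (hf : MemLp f 2 μ) (hg : MemLp g 2 μ)
    (hx : AEStronglyMeasurable x μ) (hy : AEStronglyMeasurable y μ)
    (hxb : ∃ C : ℝ, ∀ ω, ‖x ω‖ ≤ C) (hyb : ∃ C : ℝ, ∀ ω, ‖y ω‖ ≤ C) :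
    Integrable (fun ω => f ω * g ω * ⟪x ω, y ω⟫) μ := by
  obtain ⟨C, hC⟩ := hxb
  obtain ⟨D, hD⟩ := hyb
  refine Integrable.mul_bdd (c := C * D) (hf.integrable_mul hg) (hx.inner hy)
    (.of_forall fun ω => ?_)
  exact (norm_inner_le_norm _ _).trans
    (mul_le_mul (hC ω) (hD ω) (norm_nonneg _) ((norm_nonneg _).trans (hC ω)))

/-- Orthogonality of simple stochastic integrals: if `M, N` are
real-valued square-integrable martingales on `[0,T]` whose product `M N` is again a
martingale, then for bounded `𝓕_{t_i}`-measurable `H`-valued random variables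
`X_i, Y_i` over a partition `0 = t_1 < … < t_{n+1} = T` one has
`𝔼[⟨∑ X_i (M_{t_{i+1}} − M_{t_i}), ∑ Y_i (N_{t_{i+1}} − N_{t_i})⟩] = 0`. -/
theorem ito_simple_integrals_orthogonal
    {Ω H : Type*} {m : MeasurableSpace Ω} (μ : Measure Ω) [IsProbabilityMeasure μ]
    [NormedAddCommGroup H] [InnerProductSpace ℝ H] [CompleteSpace H]
    [TopologicalSpace.SeparableSpace H]
    (𝓕 : MeasureTheory.Filtration ℝ m) (T : ℝ) (hT : 0 < T)
    (M N : ℝ → Ω → ℝ)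
    -- `M` is a square-integrable martingale on `[0,T]`:
    (hMadapted : ∀ t ∈ Icc (0 : ℝ) T, StronglyMeasurable[𝓕 t] (M t))
    (hMsq : ∀ t ∈ Icc (0 : ℝ) T, Integrable (fun ω => (M t ω) ^ 2) μ)
    (hMmart : ∀ s t : ℝ, 0 ≤ s → s ≤ t → t ≤ T → μ[M t | 𝓕 s] =ᵐ[μ] M s)
    -- `N` is a square-integrable martingale on `[0,T]`:
    (hNadapted : ∀ t ∈ Icc (0 : ℝ) T, StronglyMeasurable[𝓕 t] (N t))
    (hNsq : ∀ t ∈ Icc (0 : ℝ) T, Integrable (fun ω => (N t ω) ^ 2) μ)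
    (hNmart : ∀ s t : ℝ, 0 ≤ s → s ≤ t → t ≤ T → μ[N t | 𝓕 s] =ᵐ[μ] N s)
    -- the product `M N` is again a martingale on `[0,T]`:
    (hMN : ∀ s t : ℝ, 0 ≤ s → s ≤ t → t ≤ T →
      μ[fun ω => M t ω * N t ω | 𝓕 s] =ᵐ[μ] fun ω => M s ω * N s ω)
    -- the partition `0 = t_1 < t_2 < … < t_{n+1} = T`:
    (n : ℕ) (τ : Fin (n + 1) → ℝ) (hτ : StrictMono τ)
    (hτ0 : τ 0 = 0) (hτT : τ (Fin.last n) = T)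
    -- the bounded `𝓕_{t_i}`-measurable random variables `X_i`, `Y_i`:
    (X Y : Fin n → Ω → H)
    (hXmeas : ∀ i : Fin n, StronglyMeasurable[𝓕 (τ i.castSucc)] (X i))
    (hXbdd : ∀ i : Fin n, ∃ Cb : ℝ, ∀ ω, ‖X i ω‖ ≤ Cb)
    (hYmeas : ∀ i : Fin n, StronglyMeasurable[𝓕 (τ i.castSucc)] (Y i))
    (hYbdd : ∀ i : Fin n, ∃ Cb : ℝ, ∀ ω, ‖Y i ω‖ ≤ Cb) :
    ∫ ω, ⟪∑ i : Fin n, (M (τ i.succ) ω - M (τ i.castSucc) ω) • X i ω,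
          ∑ i : Fin n, (N (τ i.succ) ω - N (τ i.castSucc) ω) • Y i ω⟫ ∂μ = 0 := by
  have hmem (k : Fin (n + 1)) : τ k ∈ Icc (0 : ℝ) T :=
    ⟨hτ0 ▸ hτ.monotone (Fin.zero_le k), hτT ▸ hτ.monotone (Fin.le_last k)⟩
  have hM2 (k : Fin (n + 1)) : MemLp (M (τ k)) 2 μ :=
    (memLp_two_iff_integrable_sq
      ((hMadapted _ (hmem k)).mono (𝓕.le _)).aestronglyMeasurable).2 (hMsq _ (hmem k))
  have hN2 (k : Fin (n + 1)) : MemLp (N (τ k)) 2 μ :=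
    (memLp_two_iff_integrable_sq
      ((hNadapted _ (hmem k)).mono (𝓕.le _)).aestronglyMeasurable).2 (hNsq _ (hmem k))
  have hdM (i : Fin n) : MemLp (fun ω => M (τ i.succ) ω - M (τ i.castSucc) ω) 2 μ :=
    (hM2 _).sub (hM2 _)
  have hdN (i : Fin n) : MemLp (fun ω => N (τ i.succ) ω - N (τ i.castSucc) ω) 2 μ :=
    (hN2 _).sub (hN2 _)
  have hle (i : Fin n) : τ i.castSucc ≤ τ i.succ := hτ.monotone i.castSucc_lt_succ.le
  have hlt {i j : Fin n} (hij : i < j) : τ i.succ ≤ τ j.castSucc :=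
    hτ.monotone (Fin.succ_le_castSucc_iff.2 hij)
  have hint (i j : Fin n) : Integrable (fun ω => (M (τ i.succ) ω - M (τ i.castSucc) ω) *
      (N (τ j.succ) ω - N (τ j.castSucc) ω) * ⟪X i ω, Y j ω⟫) μ :=
    (hdM i).integrable_mul_mul_inner (hdN j)
      ((hXmeas i).mono (𝓕.le _)).aestronglyMeasurable
      ((hYmeas j).mono (𝓕.le _)).aestronglyMeasurable (hXbdd i) (hYbdd j)
  have hzero (i j : Fin n) : ∫ ω, (M (τ i.succ) ω - M (τ i.castSucc) ω) *
      (N (τ j.succ) ω - N (τ j.castSucc) ω) * ⟪X i ω, Y j ω⟫ ∂μ = 0 := by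
    rcases lt_trichotomy i j with hij | rfl | hij
    · have hreg (ω : Ω) : (M (τ i.succ) ω - M (τ i.castSucc) ω) *
          (N (τ j.succ) ω - N (τ j.castSucc) ω) * ⟪X i ω, Y j ω⟫ =
          ((M (τ i.succ) ω - M (τ i.castSucc) ω) * ⟪X i ω, Y j ω⟫) *
          (N (τ j.succ) ω - N (τ j.castSucc) ω) := by ring
      have hi := hint i j
      simp only [hreg] at hi ⊢
      refine integral_mul_eq_zero_of_condExp_eq_zero (𝓕.le (τ j.castSucc)) ?_
        ((hdN j).integrable one_le_two) hi
        (condExp_sub_eq_zero (𝓕.le _) (hNadapted _ (hmem _)) ((hN2 _).integrable one_le_two)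
          ((hN2 _).integrable one_le_two) (hNmart _ _ (hmem _).1 (hle j) (hmem _).2))
      exact (((hMadapted _ (hmem _)).mono (𝓕.mono (hlt hij))).sub
        ((hMadapted _ (hmem _)).mono (𝓕.mono ((hle i).trans (hlt hij))))).mul
        (((hXmeas i).mono (𝓕.mono ((hle i).trans (hlt hij)))).inner (hYmeas j))
    · have hi := hint i i
      simp only [mul_comm _ ⟪X i _, Y i _⟫] at hi ⊢
      exact integral_mul_eq_zero_of_condExp_eq_zero (𝓕.le (τ i.castSucc))
        ((hXmeas i).inner (hYmeas i)) ((hdM i).integrable_mul (hdN i)) hi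
        (condExp_sub_mul_sub_eq_zero (𝓕.le _) (hMadapted _ (hmem _)) (hNadapted _ (hmem _))
          (hM2 _) (hN2 _) (hM2 _) (hN2 _) (hMmart _ _ (hmem _).1 (hle i) (hmem _).2)
          (hNmart _ _ (hmem _).1 (hle i) (hmem _).2) (hMN _ _ (hmem _).1 (hle i) (hmem _).2))
    · have hreg (ω : Ω) : (M (τ i.succ) ω - M (τ i.castSucc) ω) *
          (N (τ j.succ) ω - N (τ j.castSucc) ω) * ⟪X i ω, Y j ω⟫ =
          ((N (τ j.succ) ω - N (τ j.castSucc) ω) * ⟪X i ω, Y j ω⟫) *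
          (M (τ i.succ) ω - M (τ i.castSucc) ω) := by ring
      have hi := hint i j
      simp only [hreg] at hi ⊢
      refine integral_mul_eq_zero_of_condExp_eq_zero (𝓕.le (τ i.castSucc)) ?_
        ((hdM i).integrable one_le_two) hi
        (condExp_sub_eq_zero (𝓕.le _) (hMadapted _ (hmem _)) ((hM2 _).integrable one_le_two)
          ((hM2 _).integrable one_le_two) (hMmart _ _ (hmem _).1 (hle i) (hmem _).2))
      exact (((hNadapted _ (hmem _)).mono (𝓕.mono (hlt hij))).sub
        ((hNadapted _ (hmem _)).mono (𝓕.mono ((hle j).trans (hlt hij))))).mul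
        ((hXmeas i).inner ((hYmeas j).mono (𝓕.mono ((hle j).trans (hlt hij)))))
  have hexp (ω : Ω) : ⟪∑ i : Fin n, (M (τ i.succ) ω - M (τ i.castSucc) ω) • X i ω,
      ∑ i : Fin n, (N (τ i.succ) ω - N (τ i.castSucc) ω) • Y i ω⟫ =
      ∑ i : Fin n, ∑ j : Fin n, (M (τ i.succ) ω - M (τ i.castSucc) ω) *
        (N (τ j.succ) ω - N (τ j.castSucc) ω) * ⟪X i ω, Y j ω⟫ := by
    simp_rw [sum_inner, inner_sum, real_inner_smul_left, real_inner_smul_right, mul_assoc]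
  simp only [hexp]
  rw [integral_finsetSum _ fun i _ => integrable_finsetSum _ fun j _ => hint i j]
  refine Finset.sum_eq_zero fun i _ => ?_
  rw [integral_finsetSum _ fun j _ => hint i j]
  exact Finset.sum_eq_zero fun j _ => hzero i j
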